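/- Truth lemma for the canonical counter-example: let H be a hypersequent unprovable in cut-free RK, let T, λ, S(H) be as in the successor-tree construction, let Γ(σ) and Δ(σ) be the common antecedent and succedent of the σ-labelled components of hypersequents in S(H), and let M = (T, R, V) be the Kripke model with worlds T, the successor order R as accessibility relation, and σ ∈ V(p) iff p ∈ Γ(σ). Then for every modal formula φ and every σ ∈ T: if φ ∈ Γ(σ) then φ is true at σ in M, and if φ ∈ Δ(σ) then φ is false at σ in M. -/

import Mathlib

/-- Modal formulas: atoms, negation, conjunction, box. -/
inductive MF : Type
  | atom : ℕ → MF
  | neg : MF → MF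
  | conj : MF → MF → MF
  | box : MF → MF

/-- A sequent: a pair of finite multisets of modal formulas. -/
structure Seqt : Type where
  ant : Multiset MF
  suc : Multiset MF

/-- The empty sequent. -/
def Seqt.empty : Seqt := ⟨0, 0⟩

/-- A hypersequent: a (nonempty, enforced in theorems) sequence of sequents. -/
abbrev Hyperseq := List Seqt

/-- A Kripke model. -/
structure KModel : Type 1 where
  W : Type
  R : W → W → Prop
  V : ℕ → W → Prop

/-- Satisfaction of a modal formula at a world. -/
def KModel.sat (M : KModel) : M.W → MF → Prop
  | w, .atom n => M.V n w
  | w, .neg φ => ¬ M.sat w φ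
  | w, .conj φ ψ => M.sat w φ ∧ M.sat w ψ
  | w, .box φ => ∀ v, M.R w v → M.sat v φ

/-- `M` is a countermodel to sequent `S` at world `w`. -/
def Countermodel (M : KModel) (w : M.W) (S : Seqt) : Prop :=
  (∀ φ ∈ S.ant, M.sat w φ) ∧ (∀ φ ∈ S.suc, ¬ M.sat w φ)

/-- `M` is a counter-example to hypersequent `H`: there is a branch of worlds
(consecutive worlds related by `R`) falsifying the components pointwise. -/
def CounterExample (M : KModel) (H : Hyperseq) : Prop :=
  ∃ ws : List M.W, List.Chain' M.R ws ∧
    List.Forall₂ (fun S w => Countermodel M w S) H ws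

/-- Which optional rules are present in a calculus (RK rules are always present). -/
structure RuleSet : Type where
  cut : Bool := false
  ec : Bool := false
  ew : Bool := false
  ee : Bool := false
  drop : Bool := false
  sym : Bool := false

/-- Derivability in a relational hypersequent calculus: the rules of RK
(axioms, internal weakening/contraction, EWL/EWR, rules for ¬, ∧, □),
plus cut and the external structural rules EC, EW, EE, Drop, Sym when enabled. -/
inductive Deriv (ρ : RuleSet) : Hyperseq → Prop
  | ax (φ : MF) : Deriv ρ [⟨{φ}, {φ}⟩]
  | wl (G H : Hyperseq) (Γ Δ : Multiset MF) (φ : MF) :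
      Deriv ρ (G ++ ⟨Γ, Δ⟩ :: H) → Deriv ρ (G ++ ⟨φ ::ₘ Γ, Δ⟩ :: H)
  | wr (G H : Hyperseq) (Γ Δ : Multiset MF) (φ : MF) :
      Deriv ρ (G ++ ⟨Γ, Δ⟩ :: H) → Deriv ρ (G ++ ⟨Γ, φ ::ₘ Δ⟩ :: H)
  | cl (G H : Hyperseq) (Γ Δ : Multiset MF) (φ : MF) :
      Deriv ρ (G ++ ⟨φ ::ₘ φ ::ₘ Γ, Δ⟩ :: H) → Deriv ρ (G ++ ⟨φ ::ₘ Γ, Δ⟩ :: H)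
  | cr (G H : Hyperseq) (Γ Δ : Multiset MF) (φ : MF) :
      Deriv ρ (G ++ ⟨Γ, φ ::ₘ φ ::ₘ Δ⟩ :: H) → Deriv ρ (G ++ ⟨Γ, φ ::ₘ Δ⟩ :: H)
  | cut (hρ : ρ.cut = true) (G H : Hyperseq) (Γ Δ Λ Θ : Multiset MF) (φ : MF) :
      Deriv ρ (G ++ ⟨Γ, φ ::ₘ Δ⟩ :: H) → Deriv ρ (G ++ ⟨φ ::ₘ Λ, Θ⟩ :: H) →
      Deriv ρ (G ++ ⟨Γ + Λ, Δ + Θ⟩ :: H)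
  | ewr (G : Hyperseq) : Deriv ρ G → Deriv ρ (G ++ [Seqt.empty])
  | ewl (G : Hyperseq) : Deriv ρ G → Deriv ρ (Seqt.empty :: G)
  | negL (G H : Hyperseq) (Γ Δ : Multiset MF) (φ : MF) :
      Deriv ρ (G ++ ⟨Γ, φ ::ₘ Δ⟩ :: H) → Deriv ρ (G ++ ⟨.neg φ ::ₘ Γ, Δ⟩ :: H)
  | negR (G H : Hyperseq) (Γ Δ : Multiset MF) (φ : MF) :
      Deriv ρ (G ++ ⟨φ ::ₘ Γ, Δ⟩ :: H) → Deriv ρ (G ++ ⟨Γ, .neg φ ::ₘ Δ⟩ :: H)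
  | andL1 (G H : Hyperseq) (Γ Δ : Multiset MF) (φ ψ : MF) :
      Deriv ρ (G ++ ⟨φ ::ₘ Γ, Δ⟩ :: H) → Deriv ρ (G ++ ⟨.conj φ ψ ::ₘ Γ, Δ⟩ :: H)
  | andL2 (G H : Hyperseq) (Γ Δ : Multiset MF) (φ ψ : MF) :
      Deriv ρ (G ++ ⟨ψ ::ₘ Γ, Δ⟩ :: H) → Deriv ρ (G ++ ⟨.conj φ ψ ::ₘ Γ, Δ⟩ :: H)
  | andR (G H : Hyperseq) (Γ Δ : Multiset MF) (φ ψ : MF) :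
      Deriv ρ (G ++ ⟨Γ, φ ::ₘ Δ⟩ :: H) → Deriv ρ (G ++ ⟨Γ, ψ ::ₘ Δ⟩ :: H) →
      Deriv ρ (G ++ ⟨Γ, .conj φ ψ ::ₘ Δ⟩ :: H)
  | boxL (G H : Hyperseq) (Γ Δ Λ Θ : Multiset MF) (φ : MF) :
      Deriv ρ (G ++ ⟨Γ, Δ⟩ :: ⟨φ ::ₘ Λ, Θ⟩ :: H) →
      Deriv ρ (G ++ ⟨.box φ ::ₘ Γ, Δ⟩ :: ⟨Λ, Θ⟩ :: H)
  | boxR (G : Hyperseq) (Γ Δ : Multiset MF) (φ : MF) :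
      Deriv ρ (G ++ [⟨Γ, Δ⟩, ⟨0, {φ}⟩]) → Deriv ρ (G ++ [⟨Γ, .box φ ::ₘ Δ⟩])
  | ec (hρ : ρ.ec = true) (G H : Hyperseq) (S : Seqt) :
      Deriv ρ (G ++ S :: S :: H) → Deriv ρ (G ++ S :: H)
  | ew (hρ : ρ.ew = true) (G H : Hyperseq) :
      Deriv ρ (G ++ H) → Deriv ρ (G ++ Seqt.empty :: H)
  | ee (hρ : ρ.ee = true) (G H : Hyperseq) (S S' : Seqt) :
      Deriv ρ (G ++ S :: S' :: H) → Deriv ρ (G ++ S' :: S :: H)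
  | drop (hρ : ρ.drop = true) (G : Hyperseq) :
      Deriv ρ (G ++ [Seqt.empty]) → Deriv ρ G
  | symm (hρ : ρ.sym = true) (G : Hyperseq) : Deriv ρ G → Deriv ρ G.reverse

/-- Labels: finite sequences of natural numbers. -/
abbrev Label := List ℕ

/-- Labelled hypersequents: sequences of labelled sequents. -/
abbrev LHyp := List (Label × Seqt)

/-- The successor order on labels: `RLab σ τ` iff `τ = σ.n` for some `n`. -/
def RLab (σ τ : Label) : Prop := ∃ n : ℕ, τ = σ ++ [n]

/-- A labelled hypersequent: nonempty, and its labels form a branch under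
the successor order. -/
def IsLabelled (L : LHyp) : Prop :=
  L ≠ [] ∧ List.Chain' (fun a b => RLab a.1 b.1) L

/-- Cut-free RK: no cut, and none of the optional external structural rules. -/
def cfRK : RuleSet := {}

/-- A labelled hypersequent is provable iff its underlying hypersequent is derivable. -/
def LProvable (ρ : RuleSet) (L : LHyp) : Prop := Deriv ρ (L.map Prod.snd)

/-- `comp L σ`: the rightmost `σ`-labelled component of `L`
(the empty sequent if there is none). -/
def comp (L : LHyp) (σ : Label) : Seqt :=
  (((L.reverse.find? (fun p => p.1 == σ)).map Prod.snd).getD Seqt.empty)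

/-- The `σ`-reduct relation on labelled hypersequents, corresponding to the rules
¬L, ¬R, ∧L, ∧R and □L.  A reduction is applicable only if it adds new material
(otherwise the reduct is identical to the original hypersequent); for ∧R, the
reduct adds the left conjunct if the result is unprovable, otherwise the right. -/
inductive Reduct (ρ : RuleSet) (σ : Label) : LHyp → LHyp → Prop
  | negL (G G' : LHyp) (Γ Δ : Multiset MF) (φ : MF) (h : φ ∉ Δ) :
      Reduct ρ σ (G ++ (σ, ⟨.neg φ ::ₘ Γ, Δ⟩) :: G')
                 (G ++ (σ, ⟨.neg φ ::ₘ Γ, φ ::ₘ Δ⟩) :: G')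
  | negR (G G' : LHyp) (Γ Δ : Multiset MF) (φ : MF) (h : φ ∉ Γ) :
      Reduct ρ σ (G ++ (σ, ⟨Γ, .neg φ ::ₘ Δ⟩) :: G')
                 (G ++ (σ, ⟨φ ::ₘ Γ, .neg φ ::ₘ Δ⟩) :: G')
  | andL (G G' : LHyp) (Γ Δ : Multiset MF) (φ ψ : MF) (h : ¬ (φ ∈ Γ ∧ ψ ∈ Γ)) :
      Reduct ρ σ (G ++ (σ, ⟨.conj φ ψ ::ₘ Γ, Δ⟩) :: G')
                 (G ++ (σ, ⟨φ ::ₘ ψ ::ₘ .conj φ ψ ::ₘ Γ, Δ⟩) :: G')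
  | andR1 (G G' : LHyp) (Γ Δ : Multiset MF) (φ ψ : MF) (h : φ ∉ Δ ∧ ψ ∉ Δ)
      (hunp : ¬ LProvable ρ (G ++ (σ, ⟨Γ, φ ::ₘ .conj φ ψ ::ₘ Δ⟩) :: G')) :
      Reduct ρ σ (G ++ (σ, ⟨Γ, .conj φ ψ ::ₘ Δ⟩) :: G')
                 (G ++ (σ, ⟨Γ, φ ::ₘ .conj φ ψ ::ₘ Δ⟩) :: G')
  | andR2 (G G' : LHyp) (Γ Δ : Multiset MF) (φ ψ : MF) (h : φ ∉ Δ ∧ ψ ∉ Δ)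
      (hprov : LProvable ρ (G ++ (σ, ⟨Γ, φ ::ₘ .conj φ ψ ::ₘ Δ⟩) :: G')) :
      Reduct ρ σ (G ++ (σ, ⟨Γ, .conj φ ψ ::ₘ Δ⟩) :: G')
                 (G ++ (σ, ⟨Γ, ψ ::ₘ .conj φ ψ ::ₘ Δ⟩) :: G')
  | boxL (G G' : LHyp) (σ' : Label) (Γ' Δ' Γ Δ : Multiset MF) (φ : MF) (h : φ ∉ Γ) :
      Reduct ρ σ (G ++ (σ', ⟨.box φ ::ₘ Γ', Δ'⟩) :: (σ, ⟨Γ, Δ⟩) :: G')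
                 (G ++ (σ', ⟨.box φ ::ₘ Γ', Δ'⟩) :: (σ, ⟨φ ::ₘ Γ, Δ⟩) :: G')

/-- `L` is `σ`-reduced: it is identical to all of its `σ`-reducts. -/
def Reduced (ρ : RuleSet) (σ : Label) (L : LHyp) : Prop :=
  ∀ L', Reduct ρ σ L L' → L' = L

/-- `L` is fully reduced: `σ`-reduced for every label `σ`. -/
def FullyReduced (ρ : RuleSet) (L : LHyp) : Prop := ∀ σ, Reduced ρ σ L

/-- One reduction step (at some label). -/
def ReductStep (ρ : RuleSet) (A B : LHyp) : Prop := ∃ σ, Reduct ρ σ A B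

/-- `L'` is a full reduction of `L`: obtained from `L` by a finite sequence of
reductions, and fully reduced. -/
def IsFullReduction (ρ : RuleSet) (L L' : LHyp) : Prop :=
  Relation.ReflTransGen (ReductStep ρ) L L' ∧ FullyReduced ρ L'

/-- `S'` extends `S`: antecedent and succedent are multiset-contained. -/
def Seqt.Ext (S' S : Seqt) : Prop := S.ant ≤ S'.ant ∧ S.suc ≤ S'.suc

/-- `L'` extends `L`: for every label of `L`, the rightmost `σ`-component of `L'`
extends that of `L`. -/
def LExtends (L' L : LHyp) : Prop :=
  ∀ σ ∈ L.map Prod.fst, Seqt.Ext (comp L' σ) (comp L σ)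

/-- The initial labelling of a hypersequent: the `i`-th component gets label
`0…0` (`i` zeros), so that the labels form a branch under the successor order. -/
def initLab (H : Hyperseq) : LHyp := H.mapIdx (fun i S => (List.replicate i 0, S))

/-- The canonical model of the successor-tree construction: worlds are the labels
in the domain of `lam` (= the tree `T`), accessibility is the successor order, and
an atom is true at `σ` iff it occurs in the antecedent `Γ(σ)` of the (rightmost)
σ-labelled component of `lam σ`. -/
def canonModel (lam : Label → Option LHyp) : KModel where
  W := { σ : Label // (lam σ).isSome }
  R := fun a b => RLab a.1 b.1
  V := fun p w => MF.atom p ∈ (comp ((lam w.1).get w.2) w.1).ant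

/-- Closure of a sequent under the propositional reductions. -/
structure Seqt.Closed (S : Seqt) : Prop where
  negL : ∀ φ, MF.neg φ ∈ S.ant → φ ∈ S.suc
  negR : ∀ φ, MF.neg φ ∈ S.suc → φ ∈ S.ant
  conjL : ∀ φ ψ, MF.conj φ ψ ∈ S.ant → φ ∈ S.ant ∧ ψ ∈ S.ant
  conjR : ∀ φ ψ, MF.conj φ ψ ∈ S.suc → φ ∈ S.suc ∨ ψ ∈ S.suc

/-- Adjacent components respect boxes in the antecedent. -/
def BoxRel (a b : Label × Seqt) : Prop := ∀ φ, MF.box φ ∈ a.2.ant → φ ∈ b.2.ant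

/-- No reduction is applicable, stated componentwise. -/
def Saturated (L : LHyp) : Prop := (∀ x ∈ L, x.2.Closed) ∧ L.IsChain BoxRel

theorem Saturated.of_isPrefix {L L' : LHyp} (h : Saturated L') (hp : L <+: L') : Saturated L := by
  obtain ⟨Q, rfl⟩ := hp
  exact ⟨fun x hx => h.1 x (List.mem_append_left Q hx), h.2.left_of_append⟩

theorem Saturated.closed {G : LHyp} {x : Label × Seqt} (h : Saturated (G ++ [x])) : x.2.Closed :=
  h.1 x (by simp)

theorem MF.ne_conj_left (φ ψ : MF) : φ ≠ .conj φ ψ := fun he => by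
  have := congrArg sizeOf he
  rw [MF.conj.sizeOf_spec] at this
  omega

theorem MF.ne_conj_right (φ ψ : MF) : ψ ≠ .conj φ ψ := fun he => by
  have := congrArg sizeOf he
  rw [MF.conj.sizeOf_spec] at this
  omega

/-- A reduction properly enlarges one component, which its predecessors show to be unsaturated. -/
theorem Reduct.exists_eq {ρ : RuleSet} {σ : Label} {A B : LHyp} (h : Reduct ρ σ A B) :
    ∃ G S S' G', A = G ++ (σ, S) :: G' ∧ B = G ++ (σ, S') :: G' ∧ S ≠ S' ∧ Seqt.Ext S' S ∧
      ¬ Saturated (G ++ [(σ, S)]) := by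
  have hcons : ∀ (Γ : Multiset MF) φ, Γ ≠ φ ::ₘ Γ := fun Γ φ => (Multiset.lt_cons_self Γ φ).ne
  cases h with
  | negL G G' Γ Δ φ h =>
    exact ⟨G, _, _, G', rfl, rfl, by simp [hcons], ⟨le_rfl, Multiset.le_cons_self _ _⟩,
      fun hs => h (hs.closed.negL φ (Multiset.mem_cons_self _ _))⟩
  | negR G G' Γ Δ φ h =>
    exact ⟨G, _, _, G', rfl, rfl, by simp [hcons], ⟨Multiset.le_cons_self _ _, le_rfl⟩,
      fun hs => h (hs.closed.negR φ (Multiset.mem_cons_self _ _))⟩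
  | andL G G' Γ Δ φ ψ h =>
    refine ⟨G, _, _, G', rfl, rfl, fun he => ?_,
      ⟨(Multiset.le_cons_self _ _).trans (Multiset.le_cons_self _ _), le_rfl⟩, fun hs => h ?_⟩
    · have := congrArg (fun S => Multiset.card S.ant) he
      simp at this
    · simpa [MF.ne_conj_left, MF.ne_conj_right] using
        hs.closed.conjL φ ψ (Multiset.mem_cons_self _ _)
  | andR1 G G' Γ Δ φ ψ h =>
    refine ⟨G, _, _, G', rfl, rfl, by simp [hcons], ⟨le_rfl, Multiset.le_cons_self _ _⟩,
      fun hs => ?_⟩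
    simpa [MF.ne_conj_left, MF.ne_conj_right, h] using
      hs.closed.conjR φ ψ (Multiset.mem_cons_self _ _)
  | andR2 G G' Γ Δ φ ψ h =>
    refine ⟨G, _, _, G', rfl, rfl, by simp [hcons], ⟨le_rfl, Multiset.le_cons_self _ _⟩,
      fun hs => ?_⟩
    simpa [MF.ne_conj_left, MF.ne_conj_right, h] using
      hs.closed.conjR φ ψ (Multiset.mem_cons_self _ _)
  | boxL G G' σ' Γ' Δ' Γ Δ φ h =>
    refine ⟨G ++ [(σ', ⟨.box φ ::ₘ Γ', Δ'⟩)], ⟨Γ, Δ⟩, ⟨φ ::ₘ Γ, Δ⟩, G', by simp, by simp,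
      by simp [hcons], ⟨Multiset.le_cons_self _ _, le_rfl⟩, fun hs => h ?_⟩
    have := hs.2
    simp only [List.append_assoc, List.singleton_append, List.isChain_append_cons_cons] at this
    exact this.2.1 φ (by simp)

theorem FullyReduced.not_reduct {ρ : RuleSet} {L B : LHyp} (h : FullyReduced ρ L) {σ : Label}
    (hr : Reduct ρ σ L B) : False := by
  obtain ⟨G, S, S', G', rfl, hB, hne, -⟩ := hr.exists_eq
  have := h σ B hr
  simp [hB, hne.symm] at this

theorem FullyReduced.saturated {ρ : RuleSet} {L : LHyp} (h : FullyReduced ρ L) :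
    Saturated L := by
  constructor
  · rintro ⟨σ, Γ, Δ⟩ hx
    obtain ⟨G, G', rfl⟩ := List.append_of_mem hx
    constructor
    · intro φ hφ
      obtain ⟨Γ, rfl⟩ := Multiset.exists_cons_of_mem hφ
      by_contra hn
      exact h.not_reduct (.negL G G' Γ Δ φ hn)
    · intro φ hφ
      obtain ⟨Δ, rfl⟩ := Multiset.exists_cons_of_mem hφ
      by_contra hn
      exact h.not_reduct (.negR G G' Γ Δ φ hn)
    · intro φ ψ hφ
      obtain ⟨Γ, rfl⟩ := Multiset.exists_cons_of_mem hφ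
      by_contra hn
      exact h.not_reduct (.andL G G' Γ Δ φ ψ fun hh => hn (by simp [hh]))
    · intro φ ψ hφ
      obtain ⟨Δ, rfl⟩ := Multiset.exists_cons_of_mem hφ
      by_contra hn
      have hn' : φ ∉ Δ ∧ ψ ∉ Δ := by
        constructor <;> intro hh <;> exact hn (by simp [hh])
      by_cases hp : LProvable ρ (G ++ (σ, ⟨Γ, φ ::ₘ .conj φ ψ ::ₘ Δ⟩) :: G')
      · exact h.not_reduct (.andR2 G G' Γ Δ φ ψ hn' hp)
      · exact h.not_reduct (.andR1 G G' Γ Δ φ ψ hn' hp)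
  · refine List.isChain_iff_getElem.2 fun i hi φ hφ => ?_
    have hL : L = L.take i ++ L[i] :: L[i + 1] :: L.drop (i + 2) := by simp
    generalize L.take i = G at hL
    generalize L.drop (i + 2) = G' at hL
    generalize L[i] = a at hL hφ
    generalize L[i + 1] = b at hL ⊢
    obtain ⟨σ', Γ', Δ'⟩ := a
    obtain ⟨σ, Γ, Δ⟩ := b
    obtain ⟨Γ', rfl⟩ := Multiset.exists_cons_of_mem hφ
    by_contra hn
    subst hL
    exact h.not_reduct (.boxL G G' σ' Γ' Δ' Γ Δ φ hn)

theorem Reduct.not_provable {ρ : RuleSet} {σ : Label} {A B : LHyp} (h : Reduct ρ σ A B)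
    (hA : ¬ LProvable ρ A) : ¬ LProvable ρ B := by
  intro hB
  apply hA
  unfold LProvable at *
  cases h with
  | negL G G' Γ Δ φ h =>
    simp only [List.map_append, List.map_cons] at *
    exact .cl _ _ _ _ _ (.negL _ _ _ _ _ hB)
  | negR G G' Γ Δ φ h =>
    simp only [List.map_append, List.map_cons] at *
    exact .cr _ _ _ _ _ (.negR _ _ _ _ _ hB)
  | andL G G' Γ Δ φ ψ h =>
    simp only [List.map_append, List.map_cons] at *
    have h1 := Deriv.andL1 _ _ _ _ _ ψ hB
    rw [Multiset.cons_swap] at h1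
    have h2 := Deriv.andL2 _ _ _ _ φ _ h1
    exact .cl _ _ _ _ _ (.cl _ _ _ _ _ h2)
  | andR1 G G' Γ Δ φ ψ h hunp =>
    exact absurd hB hunp
  | andR2 G G' Γ Δ φ ψ h hprov =>
    unfold LProvable at hprov
    simp only [List.map_append, List.map_cons] at *
    exact .cr _ _ _ _ _ (.andR _ _ _ _ _ _ hprov hB)
  | boxL G G' σ' Γ' Δ' Γ Δ φ h =>
    simp only [List.map_append, List.map_cons] at *
    exact .cl _ _ _ _ _ (.boxL _ _ _ _ _ _ _ hB)

theorem Deriv.weaken {ρ : RuleSet} {G H : Hyperseq} {Γ Δ : Multiset MF}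
    (h : Deriv ρ (G ++ ⟨Γ, Δ⟩ :: H)) (Γ' Δ' : Multiset MF) :
    Deriv ρ (G ++ ⟨Γ' + Γ, Δ' + Δ⟩ :: H) := by
  induction Γ' using Multiset.induction with
  | empty =>
    induction Δ' using Multiset.induction with
    | empty => simpa using h
    | cons a s ih => rw [Multiset.cons_add]; exact .wr _ _ _ _ _ ih
  | cons a s ih => rw [Multiset.cons_add]; exact .wl _ _ _ _ _ ih

theorem Deriv.append {ρ : RuleSet} {G : Hyperseq} (h : Deriv ρ G) (H : Hyperseq) :
    Deriv ρ (G ++ H) := by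
  induction H generalizing G with
  | nil => simpa using h
  | cons S H ih =>
    have : Deriv ρ (G ++ [S]) := by simpa using (Deriv.ewr G h).weaken S.ant S.suc
    simpa using ih this

theorem Deriv.prepend {ρ : RuleSet} {G : Hyperseq} (h : Deriv ρ G) (H : Hyperseq) :
    Deriv ρ (H ++ G) := by
  induction H with
  | nil => exact h
  | cons S H ih => simpa using (Deriv.weaken (G := []) (Deriv.ewl _ ih) S.ant S.suc)

theorem Deriv.of_mem_of_mem {ρ : RuleSet} {G H : Hyperseq} {S : Seqt} {φ : MF}
    (ha : φ ∈ S.ant) (hs : φ ∈ S.suc) : Deriv ρ (G ++ S :: H) := by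
  obtain ⟨Γ, Δ⟩ := S
  obtain ⟨Γ, rfl⟩ := Multiset.exists_cons_of_mem ha
  obtain ⟨Δ, rfl⟩ := Multiset.exists_cons_of_mem hs
  have := ((Deriv.ax (ρ := ρ) φ).append H).prepend G
  have := Deriv.weaken this Γ Δ
  rwa [add_comm, add_comm Δ, Multiset.singleton_add, Multiset.singleton_add] at this

theorem LProvable.of_isPrefix {ρ : RuleSet} {L L' : LHyp} (hp : L <+: L') (h : LProvable ρ L) :
    LProvable ρ L' := by
  obtain ⟨Q, rfl⟩ := hp
  unfold LProvable
  rw [List.map_append]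
  exact Deriv.append h _

theorem LProvable.of_box_successor {ρ : RuleSet} {P : LHyp} {σ τ : Label} {S : Seqt} {ψ : MF}
    (hψ : MF.box ψ ∈ S.suc) (h : LProvable ρ ((P ++ [(σ, S)]) ++ [(τ, ⟨0, {ψ}⟩)])) :
    LProvable ρ (P ++ [(σ, S)]) := by
  obtain ⟨Γ, Δ⟩ := S
  obtain ⟨Δ, rfl⟩ := Multiset.exists_cons_of_mem hψ
  unfold LProvable at *
  simp only [List.map_append, List.map_cons, List.map_nil, List.append_assoc,
    List.singleton_append] at *
  exact .cr _ _ _ _ _ (.boxR _ _ _ _ h)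

theorem IsFullReduction.map_fst {ρ : RuleSet} {L L' : LHyp} (h : IsFullReduction ρ L L') :
    L'.map Prod.fst = L.map Prod.fst := by
  obtain ⟨h, -⟩ := h
  induction h with
  | refl => rfl
  | tail _ hs ih =>
    obtain ⟨σ, hs⟩ := hs
    obtain ⟨G, S, S', G', rfl, rfl, -⟩ := hs.exists_eq
    rw [← ih]
    simp

theorem IsFullReduction.not_provable {ρ : RuleSet} {L L' : LHyp} (h : IsFullReduction ρ L L')
    (hL : ¬ LProvable ρ L) : ¬ LProvable ρ L' := by
  obtain ⟨h, -⟩ := h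
  induction h with
  | refl => exact hL
  | tail _ hs ih => exact hs.choose_spec.not_provable ih

theorem IsLabelled.of_map_fst {L L' : LHyp} (h : IsLabelled L)
    (he : L'.map Prod.fst = L.map Prod.fst) : IsLabelled L' := by
  refine ⟨fun h0 => h.1 (by simpa [h0] using he.symm), ?_⟩
  have h2 : (L.map Prod.fst).IsChain RLab := (List.isChain_map _).2 h.2
  rw [← he] at h2
  exact (List.isChain_map _).1 h2

/-- Reducing a saturated hypersequent with one appended component only enlarges that component. -/
theorem IsFullReduction.append_singleton {ρ : RuleSet} {L L' : LHyp} {τ : Label} {S : Seqt}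
    (h : IsFullReduction ρ (L ++ [(τ, S)]) L') (hL : Saturated L) :
    ∃ S', L' = L ++ [(τ, S')] ∧ Seqt.Ext S' S := by
  obtain ⟨h, -⟩ := h
  induction h with
  | refl => exact ⟨S, rfl, le_rfl, le_rfl⟩
  | tail _ hs ih =>
    obtain ⟨T, rfl, hT⟩ := ih
    obtain ⟨σ, hs⟩ := hs
    obtain ⟨G, U, U', G', he, rfl, -, hU, hns⟩ := hs.exists_eq
    rcases List.eq_nil_or_concat G' with rfl | ⟨Q, x, rfl⟩
    · obtain ⟨rfl, hlast⟩ := List.append_inj' he rfl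
      simp only [List.cons.injEq, Prod.mk.injEq, and_true] at hlast
      obtain ⟨rfl, rfl⟩ := hlast
      exact ⟨U', rfl, hT.1.trans hU.1, hT.2.trans hU.2⟩
    · refine absurd (hL.of_isPrefix ?_) hns
      rw [List.concat_eq_append, ← List.cons_append, ← List.append_assoc] at he
      obtain ⟨rfl, -⟩ := List.append_inj' he rfl
      exact ⟨Q, by simp⟩

theorem comp_append_singleton (P : LHyp) (σ : Label) (S : Seqt) :
    comp (P ++ [(σ, S)]) σ = S := by
  simp [comp]

theorem length_initLab (H : Hyperseq) : (initLab H).length = H.length := by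
  simp [initLab]

theorem map_snd_initLab (H : Hyperseq) : (initLab H).map Prod.snd = H := by
  apply List.ext_getElem <;> simp [initLab]

theorem isLabelled_initLab {H : Hyperseq} (hne : H ≠ []) : IsLabelled (initLab H) := by
  refine ⟨by simpa [initLab] using hne, ?_⟩
  refine List.isChain_iff_getElem.2 fun i hi => ⟨0, ?_⟩
  simp [initLab, List.replicate_succ']

/-- The properties of the hypersequent attached to a node of the successor tree. -/
structure NodeInvariant (ρ : RuleSet) (σ : Label) (L : LHyp) : Prop where
  last : ∃ P S, L = P ++ [(σ, S)]
  labelled : IsLabelled L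
  not_provable : ¬ LProvable ρ L
  saturated : Saturated L

theorem NodeInvariant.successor {ρ : RuleSet} {σ : Label} {L L' : LHyp} {k : ℕ} {ψ : MF}
    (hL : NodeInvariant ρ σ L) (hψ : MF.box ψ ∈ (comp L σ).suc) {Red : LHyp → LHyp}
    (hRed : ∀ L, IsLabelled L → ¬ LProvable ρ L → IsFullReduction ρ L (Red L))
    (hL' : L' = Red (L ++ [(σ ++ [k], ⟨0, {ψ}⟩)])) :
    NodeInvariant ρ (σ ++ [k]) L' ∧ ∃ S, L' = L ++ [(σ ++ [k], S)] ∧ ψ ∈ S.suc := by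
  obtain ⟨⟨P, S, rfl⟩, hlab, hnp, hsat⟩ := hL
  rw [comp_append_singleton] at hψ
  have hlab' : IsLabelled ((P ++ [(σ, S)]) ++ [(σ ++ [k], ⟨0, {ψ}⟩)]) := by
    refine ⟨by simp, ?_⟩
    refine List.isChain_append.2 ⟨hlab.2, by simp, ?_⟩
    simp [RLab]
  have hnp' := mt (LProvable.of_box_successor (τ := σ ++ [k]) hψ) hnp
  have hr := hRed _ hlab' hnp'
  rw [← hL'] at hr
  obtain ⟨S', he, hS'⟩ := hr.append_singleton hsat
  refine ⟨⟨⟨_, _, he⟩, hlab'.of_map_fst hr.map_fst, hr.not_provable hnp', hr.2.saturated⟩,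
    S', he, Multiset.mem_of_le hS'.2 (by simp)⟩

theorem take_succ_eq_of_map_fst_initLab {H : Hyperseq} {L : LHyp}
    (he : L.map Prod.fst = (initLab H).map Prod.fst) {i : ℕ} (hi : i < H.length) :
    ∃ S, L.take (i + 1) = L.take i ++ [(List.replicate i 0, S)] := by
  have hlen : L.length = H.length := by
    simpa [length_initLab] using congrArg List.length he
  have hi' : i < L.length := hlen ▸ hi
  refine ⟨L[i].2, ?_⟩
  have h1 : L[i].1 = List.replicate i 0 := by
    have : (L.map Prod.fst)[i]'(by simpa using hi') =
        ((initLab H).map Prod.fst)[i]'(by simpa [length_initLab] using hi) := by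
      simp only [he]
    simpa [initLab] using this
  rw [← h1]
  exact (List.take_append_getElem hi').symm

theorem IsFullReduction.nodeInvariant_take {ρ : RuleSet} {H : Hyperseq} {L : LHyp} (hne : H ≠ [])
    (hH : ¬ Deriv ρ H) (hL : IsFullReduction ρ (initLab H) L) {i : ℕ} (hi : i < H.length) :
    NodeInvariant ρ (List.replicate i 0) (L.take (i + 1)) := by
  obtain ⟨S, hS⟩ := take_succ_eq_of_map_fst_initLab hL.map_fst hi
  have hp : L.take (i + 1) <+: L := List.take_prefix _ _
  have hnp : ¬ LProvable ρ (initLab H) := by rwa [LProvable, map_snd_initLab]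
  refine ⟨⟨_, _, hS⟩, ⟨by simp [hS], ?_⟩, mt (LProvable.of_isPrefix hp) (hL.not_provable hnp),
    hL.2.saturated.of_isPrefix hp⟩
  exact ((isLabelled_initLab hne).of_map_fst hL.map_fst).2.take _

/-- Truth lemma for the canonical counter-example: given the successor-tree
construction for a hypersequent `H` unprovable in cut-free RK, every formula in
`Γ(σ)` is true at `σ` in the canonical model, and every formula in `Δ(σ)` is
false at `σ`. -/
theorem truth_lemma
    (H : Hyperseq) (hne : H ≠ []) (hH : ¬ Deriv cfRK H)
    (Red : LHyp → LHyp)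
    (hRed : ∀ L, IsLabelled L → ¬ LProvable cfRK L → IsFullReduction cfRK L (Red L))
    (lam : Label → Option LHyp)
    (hspine : ∀ i < H.length,
      lam (List.replicate i 0) = some ((Red (initLab H)).take (i + 1)))
    (hdom : ∀ (σ : Label) (k : ℕ), lam (σ ++ [k]) ≠ none →
      (∃ i < H.length, σ ++ [k] = List.replicate i 0) ∨
      (∃ (L : LHyp) (ψ : MF), lam σ = some L ∧ MF.box ψ ∈ (comp L σ).suc ∧
        lam (σ ++ [k]) = some (Red (L ++ [(σ ++ [k], ⟨0, {ψ}⟩)]))))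
    (hcomplete : ∀ (σ : Label) (L : LHyp) (ψ : MF), lam σ = some L →
      MF.box ψ ∈ (comp L σ).suc →
      ∃ k : ℕ, lam (σ ++ [k]) = some (Red (L ++ [(σ ++ [k], ⟨0, {ψ}⟩)]))) :
    ∀ (φ : MF) (σ : Label) (h : (lam σ).isSome),
      (φ ∈ (comp ((lam σ).get h) σ).ant → (canonModel lam).sat ⟨σ, h⟩ φ) ∧
      (φ ∈ (comp ((lam σ).get h) σ).suc → ¬ (canonModel lam).sat ⟨σ, h⟩ φ) := by
  have hinit : IsFullReduction cfRK (initLab H) (Red (initLab H)) :=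
    hRed _ (isLabelled_initLab hne) (by rwa [LProvable, map_snd_initLab])
  have hpos : 0 < H.length := List.length_pos_iff.2 hne
  have hinv : ∀ σ L, lam σ = some L → NodeInvariant cfRK σ L := by
    intro σ
    induction σ using List.reverseRecOn with
    | nil =>
      intro L hL
      rw [← List.replicate_zero (a := 0), hspine 0 hpos] at hL
      cases hL
      exact hinit.nodeInvariant_take hne hH hpos
    | append_singleton σ k ih =>
      intro L hL
      rcases hdom σ k (by simp [hL]) with ⟨i, hi, he⟩ | ⟨L₀, ψ, hL₀, hψ, he⟩
      · rw [he, hspine i hi] at hL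
        cases hL
        rw [he]
        exact hinit.nodeInvariant_take hne hH hi
      · rw [hL] at he
        exact ((ih L₀ hL₀).successor hψ hRed (Option.some.inj he)).1
  have hsucc : ∀ σ k L L', lam σ = some L → lam (σ ++ [k]) = some L' →
      ∃ S, L' = L ++ [(σ ++ [k], S)] := by
    intro σ k L L' hL hL'
    rcases hdom σ k (by simp [hL']) with ⟨i, hi, he⟩ | ⟨L₀, ψ, hL₀, hψ, he⟩
    · obtain _ | i := i
      · simp at he
      · rw [he, hspine _ hi] at hL'
        rw [List.replicate_succ'] at he
        obtain ⟨rfl, -⟩ := List.append_inj' he rfl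
        rw [hspine _ (by omega)] at hL
        cases hL
        cases hL'
        rw [he, ← List.replicate_succ']
        exact take_succ_eq_of_map_fst_initLab hinit.map_fst hi
    · rw [hL] at hL₀
      cases hL₀
      rw [hL'] at he
      obtain ⟨-, S, hS, -⟩ := (hinv σ L hL).successor hψ hRed (Option.some.inj he)
      exact ⟨S, hS⟩
  intro φ
  induction φ with
  | atom p =>
    refine fun σ h => ⟨id, fun hs ha => ?_⟩
    obtain ⟨L, hL⟩ := Option.isSome_iff_exists.1 h
    obtain ⟨⟨P, S, rfl⟩, -, hnp, -⟩ := hinv σ L hL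
    simp only [KModel.sat, canonModel, hL, Option.get_some, comp_append_singleton] at hs ha
    refine hnp ?_
    unfold LProvable
    rw [List.map_append]
    exact Deriv.of_mem_of_mem ha hs
  | neg φ ih =>
    intro σ h
    obtain ⟨L, hL⟩ := Option.isSome_iff_exists.1 h
    obtain ⟨⟨P, S, rfl⟩, -, -, hsat⟩ := hinv σ L hL
    have hc : S.Closed := hsat.1 (σ, S) (by simp)
    have := ih σ h
    simp only [KModel.sat, hL, Option.get_some, comp_append_singleton] at this ⊢
    exact ⟨fun hn => this.2 (hc.negL φ hn), fun hn hf => hf (this.1 (hc.negR φ hn))⟩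
  | conj φ ψ ihφ ihψ =>
    intro σ h
    obtain ⟨L, hL⟩ := Option.isSome_iff_exists.1 h
    obtain ⟨⟨P, S, rfl⟩, -, -, hsat⟩ := hinv σ L hL
    have hc : S.Closed := hsat.1 (σ, S) (by simp)
    have h1 := ihφ σ h
    have h2 := ihψ σ h
    simp only [KModel.sat, hL, Option.get_some, comp_append_singleton] at h1 h2 ⊢
    refine ⟨fun hn => ⟨h1.1 (hc.conjL φ ψ hn).1, h2.1 (hc.conjL φ ψ hn).2⟩, fun hn hf => ?_⟩
    rcases hc.conjR φ ψ hn with hm | hm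
    · exact h1.2 hm hf.1
    · exact h2.2 hm hf.2
  | box φ ih =>
    intro σ h
    obtain ⟨L, hL⟩ := Option.isSome_iff_exists.1 h
    have hget : (lam σ).get h = L := by simp [hL]
    rw [hget]
    refine ⟨?_, fun hs hf => ?_⟩
    · rintro ha ⟨τ, hτ⟩ ⟨k, hk⟩
      obtain rfl : τ = σ ++ [k] := hk
      obtain ⟨L', hL'⟩ := Option.isSome_iff_exists.1 hτ
      have hsat := (hinv _ _ hL').saturated
      obtain ⟨P, S, rfl⟩ := (hinv σ L hL).last
      obtain ⟨S', rfl⟩ := hsucc σ k _ L' hL hL'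
      refine (ih _ hτ).1 ?_
      rw [comp_append_singleton] at ha
      simp only [hL', Option.get_some, comp_append_singleton]
      have hc := hsat.2
      simp only [List.append_assoc, List.singleton_append, List.isChain_append_cons_cons] at hc
      exact hc.2.1 φ ha
    · obtain ⟨k, hk⟩ := hcomplete σ L φ hL hs
      obtain ⟨-, S, hS, hmem⟩ := (hinv σ L hL).successor (k := k) hs hRed rfl
      rw [hS] at hk
      have hτ : (lam (σ ++ [k])).isSome := by simp [hk]
      refine (ih _ hτ).2 ?_ (hf ⟨_, hτ⟩ ⟨k, rfl⟩)
      simpa only [hk, Option.get_some, comp_append_singleton] using hmem
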